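/- 2^{1/3} · P(1/3, 2/3) = (2 + √3) · P(2/3, 4/3). -/

import Mathlib

open Real

/-- Ascending Pochhammer symbol `(x)_k = x(x+1)⋯(x+k−1)`. -/
noncomputable def poch (x : ℝ) (k : ℕ) : ℝ := (ascPochhammer ℝ k).eval x

/-- The Beta function quotient `B(x,y) = Γ(x)Γ(y)/Γ(x+y)`. -/
noncomputable def betaR (x y : ℝ) : ℝ := Gamma x * Gamma y / Gamma (x + y)

/-- Generalized hypergeometric series `₃F₂(a₁,a₂,a₃; b₁,b₂; z)`. -/
noncomputable def F32 (a1 a2 a3 b1 b2 z : ℝ) : ℝ :=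
  ∑' k : ℕ, (poch a1 k * poch a2 k * poch a3 k)
      / (poch b1 k * poch b2 k * (k.factorial : ℝ)) * z ^ k

/-- The hypergeometric period value `P(r,s) = π · B(r, s−r) · ₃F₂(1/2,1/2,r; 1,s; 1)`. -/
noncomputable def P (r s : ℝ) : ℝ := π * betaR r (s - r) * F32 (1/2) (1/2) r 1 s 1

open Filter Topology

lemma poch_zero (x : ℝ) : poch x 0 = 1 := by simp [poch]

lemma poch_succ (x : ℝ) (k : ℕ) : poch x (k + 1) = poch x k * (x + k) := by
  simp [poch, ascPochhammer_succ_eval]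

lemma poch_pos {x : ℝ} (hx : 0 < x) (k : ℕ) : 0 < poch x k := ascPochhammer_pos k x hx

lemma mul_poch_add_one (x : ℝ) (k : ℕ) : x * poch (x + 1) k = poch x k * (x + k) := by
  induction k with
  | zero => simp [poch_zero]
  | succ k ih =>
    rw [poch_succ, poch_succ, ← mul_assoc, ih]
    push_cast
    ring

lemma poch_one (k : ℕ) : poch 1 k = k.factorial := by
  induction k with
  | zero => simp [poch_zero]
  | succ k ih =>
    rw [poch_succ, ih, Nat.factorial_succ]
    push_cast
    ring

lemma Gamma_add_natCast {x : ℝ} (hx : 0 < x) (n : ℕ) :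
    Gamma (x + n) = poch x n * Gamma x := by
  induction n with
  | zero => simp [poch_zero]
  | succ n ih =>
    have : x + ((n + 1 : ℕ) : ℝ) = (x + n) + 1 := by push_cast; ring
    rw [this, Gamma_add_one (by positivity), ih, poch_succ]
    ring

lemma poch_eq_prod (x : ℝ) (n : ℕ) : poch x n = ∏ j ∈ Finset.range n, (x + j) := by
  induction n with
  | zero => simp [poch_zero]
  | succ n ih => rw [poch_succ, ih, Finset.prod_range_succ]

lemma GammaSeq_eq_div_poch (x : ℝ) (n : ℕ) :
    GammaSeq x n = (n : ℝ) ^ x * n.factorial / poch x (n + 1) := by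
  rw [GammaSeq, poch_eq_prod]

/-- The `k`-th term of Watson's series `₃F₂(1/2, 1/2, c; 1, 2c; 1)`. -/
noncomputable def watsonTerm (c : ℝ) (k : ℕ) : ℝ :=
  poch (1/2) k * poch (1/2) k * poch c k / (poch 1 k * poch (2 * c) k * k.factorial)

/-- The Gamma quotient that makes Watson's series invariant under `c ↦ c + 1`. -/
noncomputable def watsonFactor (c : ℝ) : ℝ :=
  Gamma (c + 1/4) ^ 2 / (Gamma (c + 1/2) * Gamma c)

lemma watsonTerm_pos {c : ℝ} (hc : 0 < c) (k : ℕ) : 0 < watsonTerm c k := by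
  have h1 := poch_pos (x := 1/2) (by norm_num) k
  have h2 := poch_pos (x := 1) (by norm_num) k
  have h3 := poch_pos hc k
  have h4 := poch_pos (x := 2 * c) (by positivity) k
  unfold watsonTerm
  positivity

lemma F32_eq_tsum_watsonTerm (c : ℝ) :
    F32 (1/2) (1/2) c 1 (2 * c) 1 = ∑' k, watsonTerm c k := by
  simp [F32, watsonTerm]

lemma watsonTerm_succ {c : ℝ} (hc : 0 < c) (k : ℕ) :
    watsonTerm c (k + 1) =
      watsonTerm c k * ((1/2 + k) ^ 2 * (c + k) / ((1 + k) ^ 2 * (2 * c + k))) := by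
  have h2 := (poch_pos (x := 1) (by norm_num) k).ne'
  have h4 := (poch_pos (x := 2 * c) (by positivity) k).ne'
  have : (2 * c + k) ≠ 0 := by positivity
  unfold watsonTerm
  rw [poch_succ, poch_succ, poch_succ, poch_succ, Nat.factorial_succ]
  push_cast
  field_simp
  ring

lemma watsonTerm_add_one {c : ℝ} (hc : 0 < c) (k : ℕ) :
    watsonTerm (c + 1) k =
      watsonTerm c k * (2 * (2 * c + 1) * (c + k) / ((2 * c + k) * (2 * c + k + 1))) := by
  have h2 := (poch_pos (x := 1) (by norm_num) k).ne'
  have h4 := (poch_pos (x := 2 * c) (by positivity) k).ne'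
  have e1 : poch (c + 1) k = poch c k * (c + k) / c := by
    rw [← mul_poch_add_one]; field_simp
  have e2 : poch (2 * (c + 1)) k =
      poch (2 * c) k * (2 * c + k) * (2 * c + k + 1) / (2 * c * (2 * c + 1)) := by
    have a := mul_poch_add_one (2 * c) k
    have b := mul_poch_add_one (2 * c + 1) k
    rw [show 2 * (c + 1) = 2 * c + 1 + 1 by ring, eq_div_iff (by positivity), ← a]
    linear_combination (2 * c) * b
  have : (2 * c + k) ≠ 0 := by positivity
  have : (2 * c + k + 1) ≠ 0 := by positivity
  unfold watsonTerm
  rw [e1, e2]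
  field_simp

lemma watsonFactor_add_one {c : ℝ} (hc : 0 < c) :
    watsonFactor (c + 1) = watsonFactor c * ((c + 1/4) ^ 2 / ((c + 1/2) * c)) := by
  have h1 := (Gamma_pos_of_pos hc).ne'
  have h2 := (Gamma_pos_of_pos (show 0 < c + 1/2 by positivity)).ne'
  unfold watsonFactor
  rw [show c + 1 + 1/4 = (c + 1/4) + 1 by ring, show c + 1 + 1/2 = (c + 1/2) + 1 by ring,
    Gamma_add_one (by positivity), Gamma_add_one (by positivity), Gamma_add_one hc.ne']
  field_simp

/-- The Wilf–Zeilberger certificate for Watson's series. -/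
lemma watson_telescope {c : ℝ} (hc : 0 < c) (k : ℕ) :
    watsonTerm (c + 1) k * ((c + 1/4) ^ 2 / ((c + 1/2) * c)) - watsonTerm c k =
      ((k + 1 : ℕ) : ℝ) ^ 2 * watsonTerm c (k + 1) / (c * (2 * c + (k + 1 : ℕ))) -
        (k : ℝ) ^ 2 * watsonTerm c k / (c * (2 * c + k)) := by
  rw [watsonTerm_succ hc, watsonTerm_add_one hc]
  have : (2 * c + k) ≠ 0 := by positivity
  have : (2 * c + k + 1) ≠ 0 := by positivity
  have : (2 * c + (k + 1)) ≠ 0 := by positivity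
  have : (1 + k : ℝ) ≠ 0 := by positivity
  have : (c + 1 / 2) ≠ 0 := by positivity
  push_cast
  field_simp
  ring

lemma tendsto_watsonTerm_mul_rpow {c : ℝ} (hc : 0 < c) :
    Tendsto (fun n : ℕ => watsonTerm c (n + 1) * (n : ℝ) ^ (1 + c)) atTop
      (𝓝 (Gamma 1 ^ 2 * Gamma (2 * c) / (Gamma (1/2) ^ 2 * Gamma c))) := by
  have h1 := (Gamma_pos_of_pos hc).ne'
  have h2 := (Gamma_pos_of_pos (show (0 : ℝ) < 1/2 by norm_num)).ne'
  have key := (((GammaSeq_tendsto_Gamma 1).pow 2).mul (GammaSeq_tendsto_Gamma (2 * c))).div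
    (((GammaSeq_tendsto_Gamma (1/2)).pow 2).mul (GammaSeq_tendsto_Gamma c))
    (mul_ne_zero (pow_ne_zero 2 h2) h1)
  refine key.congr' ?_
  filter_upwards [eventually_gt_atTop 0] with n hn
  have hn' : (0 : ℝ) < n := by exact_mod_cast hn
  have p1 := (poch_pos (x := 1/2) (by norm_num) (n + 1)).ne'
  have p3 := (poch_pos hc (n + 1)).ne'
  have p4 := (poch_pos (x := 2 * c) (by positivity) (n + 1)).ne'
  have hf : (n.factorial : ℝ) ≠ 0 := by positivity
  have r2 : (n : ℝ) ^ (2 * c) = (n : ℝ) ^ c * (n : ℝ) ^ c := by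
    rw [← rpow_add hn']; ring_nf
  have r3 : ((n : ℝ) ^ ((1 : ℝ)/2)) ^ 2 = n := by
    rw [← rpow_natCast, ← rpow_mul hn'.le]; norm_num
  have r4 : (n : ℝ) ^ c ≠ 0 := (rpow_pos_of_pos hn' c).ne'
  simp only [Pi.div_apply, GammaSeq_eq_div_poch, watsonTerm, poch_one, div_pow, mul_pow, r2, r3,
    rpow_add hn', rpow_one]
  field_simp

lemma watsonTerm_isBigO {c : ℝ} (hc : 0 < c) :
    (fun n : ℕ => watsonTerm c (n + 1)) =O[atTop] fun n : ℕ => (n : ℝ) ^ (-(1 + c)) := by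
  have h := ((tendsto_watsonTerm_mul_rpow hc).isBigO_one ℝ).mul
    (Asymptotics.isBigO_refl (fun n : ℕ => (n : ℝ) ^ (-(1 + c))) atTop)
  refine h.congr' ?_ (by simp)
  filter_upwards [eventually_gt_atTop 0] with n hn
  have hn' : (0 : ℝ) < n := by exact_mod_cast hn
  rw [mul_assoc, ← rpow_add hn', add_neg_cancel, rpow_zero, mul_one]

lemma summable_watsonTerm {c : ℝ} (hc : 0 < c) : Summable (watsonTerm c) :=
  (summable_nat_add_iff 1).1 <|
    summable_of_isBigO_nat (Real.summable_nat_rpow.2 (by linarith)) (watsonTerm_isBigO hc)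

lemma tendsto_natCast_mul_watsonTerm {c : ℝ} (hc : 0 < c) :
    Tendsto (fun n : ℕ => (n : ℝ) * watsonTerm c n) atTop (𝓝 0) := by
  rw [← tendsto_add_atTop_iff_nat 1]
  have h1 : Tendsto (fun n : ℕ => (n : ℝ) * watsonTerm c (n + 1)) atTop (𝓝 0) := by
    have h := (Asymptotics.isBigO_refl (fun n : ℕ => (n : ℝ)) atTop).mul (watsonTerm_isBigO hc)
    refine h.trans_tendsto ?_
    refine ((tendsto_rpow_neg_atTop hc).comp tendsto_natCast_atTop_atTop).congr' ?_
    filter_upwards [eventually_gt_atTop 0] with n hn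
    have hn' : (0 : ℝ) < n := by exact_mod_cast hn
    simp only [Function.comp]
    rw [show -c = 1 + -(1 + c) by ring, rpow_add hn', rpow_one]
  have h2 := (tendsto_add_atTop_iff_nat 1).2 (summable_watsonTerm hc).tendsto_atTop_zero
  simpa [add_mul] using h1.add h2

lemma tsum_watsonTerm_add_one {c : ℝ} (hc : 0 < c) :
    watsonFactor (c + 1) * ∑' k, watsonTerm (c + 1) k = watsonFactor c * ∑' k, watsonTerm c k := by
  set ρ := (c + 1/4) ^ 2 / ((c + 1/2) * c) with hρ
  have hs := summable_watsonTerm hc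
  have hs' := (summable_watsonTerm (show 0 < c + 1 by positivity)).mul_right ρ
  have hlim : Tendsto (fun k : ℕ => (k : ℝ) ^ 2 * watsonTerm c k / (c * (2 * c + k)))
      atTop (𝓝 0) := by
    have h := (tendsto_natCast_mul_watsonTerm hc).div_const c
    rw [zero_div] at h
    refine squeeze_zero (fun k => ?_) (fun k => ?_) h
    · have := watsonTerm_pos hc k
      positivity
    · have := watsonTerm_pos hc k
      rw [div_le_div_iff₀ (by positivity) hc]
      have : 0 ≤ (k : ℝ) * watsonTerm c k * c * (2 * c) := by positivity
      nlinarith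
  have hsum := (hs'.sub hs).hasSum.tendsto_sum_nat
  simp only [hρ, watson_telescope hc] at hsum
  simp only [Finset.sum_range_sub
    (fun k : ℕ => (k : ℝ) ^ 2 * watsonTerm c k / (c * (2 * c + k)))] at hsum
  have h0 := tendsto_nhds_unique hsum (by simpa using hlim)
  simp only [← watson_telescope hc] at h0
  rw [(hs'.tsum_sub hs), tsum_mul_right, sub_eq_zero] at h0
  rw [watsonFactor_add_one hc, ← h0]
  ring

lemma tsum_watsonTerm_add_natCast {c : ℝ} (hc : 0 < c) (n : ℕ) :
    watsonFactor (c + n) * ∑' k, watsonTerm (c + n) k =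
      watsonFactor c * ∑' k, watsonTerm c k := by
  induction n with
  | zero => simp
  | succ n ih =>
    rw [← ih, ← tsum_watsonTerm_add_one (show 0 < c + n by positivity)]
    push_cast
    rw [add_assoc]

lemma tendsto_watsonFactor {c : ℝ} (hc : 0 < c) :
    Tendsto (fun n : ℕ => watsonFactor (c + (n + 1 : ℕ))) atTop (𝓝 1) := by
  have h1 := (Gamma_pos_of_pos hc).ne'
  have h2 := (Gamma_pos_of_pos (show 0 < c + 1/2 by positivity)).ne'
  have h3 := (Gamma_pos_of_pos (show 0 < c + 1/4 by positivity)).ne'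
  have key := (((GammaSeq_tendsto_Gamma (c + 1/2)).mul (GammaSeq_tendsto_Gamma c)).div
    ((GammaSeq_tendsto_Gamma (c + 1/4)).pow 2) (pow_ne_zero 2 h3)).mul_const (watsonFactor c)
  have e : Gamma (c + 1/2) * Gamma c / Gamma (c + 1/4) ^ 2 * watsonFactor c = 1 := by
    unfold watsonFactor
    field_simp
  rw [e] at key
  refine key.congr' ?_
  filter_upwards [eventually_gt_atTop 0] with n hn
  have hn' : (0 : ℝ) < n := by exact_mod_cast hn
  have p1 := (poch_pos hc (n + 1)).ne'
  have p2 := (poch_pos (show 0 < c + 1/2 by positivity) (n + 1)).ne'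
  have p3 := (poch_pos (show 0 < c + 1/4 by positivity) (n + 1)).ne'
  have hf : (n.factorial : ℝ) ≠ 0 := by positivity
  have r1 : ((n : ℝ) ^ ((1 : ℝ)/2)) = ((n : ℝ) ^ ((1 : ℝ)/4)) ^ 2 := by
    rw [← rpow_natCast, ← rpow_mul hn'.le]; norm_num
  have r2 : (n : ℝ) ^ c ≠ 0 := (rpow_pos_of_pos hn' c).ne'
  have r3 : (n : ℝ) ^ ((1 : ℝ)/4) ≠ 0 := (rpow_pos_of_pos hn' _).ne'
  have s1 : c + ((n + 1 : ℕ) : ℝ) + 1/4 = (c + 1/4) + ((n + 1 : ℕ) : ℝ) := by ring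
  have s2 : c + ((n + 1 : ℕ) : ℝ) + 1/2 = (c + 1/2) + ((n + 1 : ℕ) : ℝ) := by ring
  simp only [watsonFactor, s1, s2, Gamma_add_natCast hc,
    Gamma_add_natCast (show 0 < c + 1/2 by positivity),
    Gamma_add_natCast (show 0 < c + 1/4 by positivity), Pi.div_apply, GammaSeq_eq_div_poch,
    rpow_add hn', r1]
  field_simp

lemma tendsto_poch_div_poch (c : ℝ) (k : ℕ) :
    Tendsto (fun n : ℕ => poch (c + n) k / poch (2 * (c + n)) k) atTop (𝓝 ((1/2) ^ k)) := by
  induction k with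
  | zero => simp [poch_zero]
  | succ k ih =>
    have h : Tendsto (fun n : ℕ => (c + n + k) / (2 * (c + n) + k)) atTop (𝓝 (1/2)) := by
      have h1 : Tendsto (fun n : ℕ => 2 * (c + n) + k) atTop atTop :=
        tendsto_atTop_add_const_right _ _ <| Tendsto.const_mul_atTop (by norm_num) <|
          tendsto_atTop_add_const_left _ _ tendsto_natCast_atTop_atTop
      have h2 := (h1.inv_tendsto_atTop.const_mul ((k : ℝ)/2)).const_add (1/2)
      rw [mul_zero, add_zero] at h2
      refine h2.congr' ?_
      filter_upwards [h1.eventually_gt_atTop 0] with n hn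
      simp only [Pi.inv_apply]
      field_simp
      ring
    refine (ih.mul h).congr fun n => ?_
    rw [poch_succ, poch_succ, div_mul_div_comm]

lemma poch_div_poch_le {c d : ℝ} (hc : 0 < c) (hcd : c ≤ d) (k : ℕ) :
    poch d k / poch (2 * d) k ≤ poch c k / poch (2 * c) k := by
  have hd := hc.trans_le hcd
  induction k with
  | zero => simp [poch_zero]
  | succ k ih =>
    rw [poch_succ, poch_succ, poch_succ, poch_succ, ← div_mul_div_comm, ← div_mul_div_comm]
    have h1 := poch_pos hc k
    have h2 := poch_pos (x := 2 * c) (by positivity) k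
    refine mul_le_mul ih ?_ (by positivity) (by positivity)
    rw [div_le_div_iff₀ (by positivity) (by positivity)]
    have := mul_le_mul_of_nonneg_right hcd (Nat.cast_nonneg (α := ℝ) k)
    nlinarith

lemma watsonTerm_eq_mul (c : ℝ) (k : ℕ) :
    watsonTerm c k = poch (1/2) k ^ 2 / (k.factorial : ℝ) ^ 2 * (poch c k / poch (2 * c) k) := by
  rw [watsonTerm, poch_one, div_mul_div_comm]
  ring

lemma tendsto_tsum_watsonTerm {c : ℝ} (hc : 0 < c) :
    Tendsto (fun n : ℕ => ∑' k, watsonTerm (c + n) k) atTop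
      (𝓝 (∑' k : ℕ, poch (1/2) k ^ 2 / (k.factorial : ℝ) ^ 2 * (1/2) ^ k)) := by
  refine tendsto_tsum_of_dominated_convergence (summable_watsonTerm hc) (fun k => ?_)
    (Eventually.of_forall fun n k => ?_)
  · simp only [watsonTerm_eq_mul]
    exact (tendsto_poch_div_poch c k).const_mul _
  · rw [Real.norm_of_nonneg (watsonTerm_pos (by positivity) k).le, watsonTerm_eq_mul,
      watsonTerm_eq_mul]
    exact mul_le_mul_of_nonneg_left
      (poch_div_poch_le hc (le_add_of_nonneg_right n.cast_nonneg) k) (by positivity)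

/-- Watson's summation theorem for `a = b = 1/2`, with the constant left as the series
`₂F₁(1/2, 1/2; 1; 1/2)`. -/
lemma watsonFactor_mul_tsum {c : ℝ} (hc : 0 < c) :
    watsonFactor c * ∑' k, watsonTerm c k =
      ∑' k : ℕ, poch (1/2) k ^ 2 / (k.factorial : ℝ) ^ 2 * (1/2) ^ k := by
  have h := (tendsto_watsonFactor hc).mul
    ((tendsto_add_atTop_iff_nat 1).2 (tendsto_tsum_watsonTerm hc))
  simp only [tsum_watsonTerm_add_natCast hc, one_mul] at h
  exact tendsto_nhds_unique tendsto_const_nhds h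

lemma P_two_mul {c : ℝ} (hc : 0 < c) :
    P c (2 * c) = π * √π * 2 ^ (1 - 2 * c) * (Gamma c / Gamma (c + 1/4)) ^ 2 *
      ∑' k : ℕ, poch (1/2) k ^ 2 / (k.factorial : ℝ) ^ 2 * (1/2) ^ k := by
  have h1 := (Gamma_pos_of_pos hc).ne'
  have h2 := (Gamma_pos_of_pos (show 0 < c + 1/2 by positivity)).ne'
  have h3 := (Gamma_pos_of_pos (show 0 < c + 1/4 by positivity)).ne'
  have h4 := (Gamma_pos_of_pos (show 0 < 2 * c by positivity)).ne'
  have hd := Gamma_mul_Gamma_add_half c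
  rw [P, F32_eq_tsum_watsonTerm, ← watsonFactor_mul_tsum hc, watsonFactor, betaR,
    show 2 * c - c = c by ring, ← two_mul]
  generalize Gamma (c + 1/2) = G at h2 hd ⊢
  field_simp
  linear_combination (∑' k, watsonTerm c k) * hd

lemma Gamma_quotient_sq :
    2 * (Gamma (1/3) * Gamma (11/12)) ^ 2 = (2 + √3) * (Gamma (2/3) * Gamma (7/12)) ^ 2 := by
  have d1 := Gamma_mul_Gamma_add_half (1/12)
  have d2 := Gamma_mul_Gamma_add_half (1/6)
  have d3 := Gamma_mul_Gamma_one_sub (1/12)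
  norm_num at d1 d2 d3
  have hsin : 0 < sin (π * (1/12)) := sin_pos_of_pos_of_lt_pi (by positivity) (by
    linarith [pi_pos])
  have hs2 : sin (π * (1/12)) ^ 2 = (2 - √3) / 4 := by
    rw [sin_sq_eq_half_sub, show 2 * (π * (1/12)) = π / 6 by ring, cos_pi_div_six]
    ring
  have h3 : √3 ^ 2 = 3 := sq_sqrt (by norm_num)
  have hpi : √π ^ 2 = π := sq_sqrt pi_pos.le
  have h8 : ((2 : ℝ) ^ ((5 : ℝ)/6) * 2 ^ ((2 : ℝ)/3)) ^ 2 = 8 := by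
    rw [← rpow_add (by norm_num), ← rpow_natCast, ← rpow_mul (by norm_num)]
    norm_num
  have hx : Gamma (2/3) * Gamma (7/12) =
      2 ^ ((5 : ℝ)/6) * 2 ^ ((2 : ℝ)/3) * sin (π * (1/12)) * (Gamma (1/3) * Gamma (11/12)) := by
    have hA : Gamma (1/12) * Gamma (1/6) ≠ 0 := by positivity
    have d4 : Gamma (1/12) * Gamma (11/12) * sin (π * (1/12)) = π := by
      rw [d3, div_mul_cancel₀ _ hsin.ne']
    refine mul_left_cancel₀ hA ?_
    linear_combination (Gamma (1/6) * Gamma (2/3)) * d1 +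
      (Gamma (1/6) * 2 ^ ((5 : ℝ)/6) * √π) * d2 +
      (Gamma (1/6) * 2 ^ ((5 : ℝ)/6) * Gamma (1/3) * 2 ^ ((2 : ℝ)/3)) * hpi -
      (Gamma (1/6) * 2 ^ ((5 : ℝ)/6) * Gamma (1/3) * 2 ^ ((2 : ℝ)/3)) * d4
  rw [hx, mul_pow _ (Gamma (1/3) * _), mul_pow _ (sin _), h8, hs2]
  linear_combination (2 * (Gamma (1/3) * Gamma (11/12)) ^ 2) * h3

/-- `2^{1/3} · P(1/3, 2/3) = (2 + √3) · P(2/3, 4/3)`. -/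
theorem P_relation_one_third :
    (2 : ℝ) ^ ((1 : ℝ)/3) * P (1/3) (2/3) = (2 + Real.sqrt 3) * P (2/3) (4/3) := by
  have e1 := P_two_mul (c := 1/3) (by norm_num)
  have e2 := P_two_mul (c := 2/3) (by norm_num)
  rw [show 2 * ((1 : ℝ)/3) = 2/3 by norm_num, show 1 - (2 : ℝ)/3 = 1/3 by norm_num,
    show (1 : ℝ)/3 + 1/4 = 7/12 by norm_num] at e1
  rw [show 2 * ((2 : ℝ)/3) = 4/3 by norm_num, show 1 - (4 : ℝ)/3 = -(1/3) by norm_num,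
    show (2 : ℝ)/3 + 1/4 = 11/12 by norm_num, rpow_neg (by norm_num)] at e2
  have h1 := Gamma_pos_of_pos (show (0 : ℝ) < 7/12 by norm_num)
  have h2 := Gamma_pos_of_pos (show (0 : ℝ) < 11/12 by norm_num)
  have h3 : ((2 : ℝ) ^ ((1 : ℝ)/3)) ^ 3 = 2 := by
    rw [← rpow_natCast, ← rpow_mul (by norm_num)]
    norm_num
  have h4 : (0 : ℝ) < 2 ^ ((1 : ℝ)/3) := by positivity
  have key := Gamma_quotient_sq
  rw [e1, e2]
  generalize (2 : ℝ) ^ ((1 : ℝ)/3) = a at h3 h4 ⊢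
  generalize (∑' k : ℕ, poch (1/2) k ^ 2 / (k.factorial : ℝ) ^ 2 * (1/2) ^ k) = S
  have hq : a * a * (Gamma (1/3) / Gamma (7/12)) ^ 2 =
      (2 + √3) * a⁻¹ * (Gamma (2/3) / Gamma (11/12)) ^ 2 := by
    field_simp
    linear_combination key + (Gamma (1/3) * Gamma (11/12)) ^ 2 * h3
  linear_combination (π * √π * S) * hq
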